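/- Let p, q : [0,1) → ℝ be integrable, ξ ∈ [0,1), η ∈ ℝ, n ∈ ℕ, n ≥ 1, and let k* ∈ {1,…,2^n} be the index with ξ ∈ I_n(k*). Write p̃_n = S_{2^n}p and q̃_n = S_{2^n}q. If ȳ_n is a Walsh polynomial of degree < 2^n satisfying ȳ_n(x) = η + S_{2^n}( ∫_ξ^{·} (q̃_n(t) − p̃_n(t) ȳ_n(t)) dt )(x) for all x ∈ [0,1), then for every i ∈ {1,…,2^n} with i < k*: ȳ_n((i−1)/2^n) · (1 − p̃_n((i−1)/2^n)/2^{n+1}) = η + (q̃_n((k*−1)/2^n) − p̃_n((k*−1)/2^n) ȳ_n((k*−1)/2^n))·((k*−1)/2^n − ξ) − Σ_{k=i+1}^{k*−1} (q̃_n((k−1)/2^n) − p̃_n((k−1)/2^n) ȳ_n((k−1)/2^n))/2^n − q̃_n((i−1)/2^n)/2^{n+1}. -/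

import Mathlib

open MeasureTheory Matrix

/-- The `k`-th binary digit of `x ∈ [0,1)`, using the expansion terminating in zeros
for dyadic rationals. -/
noncomputable def binDigit (k : ℕ) (x : ℝ) : ℕ := ⌊x * 2 ^ (k + 1)⌋.toNat % 2

/-- Rademacher functions `r_k(x) = (-1)^{x_k}`. -/
noncomputable def rademacher (k : ℕ) (x : ℝ) : ℝ := (-1 : ℝ) ^ binDigit k x

/-- Walsh–Paley functions `ω_n(x) = ∏_k r_k(x)^{n_k}`. -/
noncomputable def walsh (n : ℕ) (x : ℝ) : ℝ :=
  ∏ k ∈ Finset.range n, if n.testBit k then rademacher k x else 1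

/-- Walsh–Fourier coefficient `f̂_k = ∫₀¹ f ω_k`. -/
noncomputable def fcoef (f : ℝ → ℝ) (k : ℕ) : ℝ := ∫ x in (0:ℝ)..1, f x * walsh k x

/-- The `2^n`-th partial sum of the Walsh–Fourier series:
`S_{2^n} f (x) = ∑_{k<2^n} f̂_k ω_k(x)`. -/
noncomputable def S2 (n : ℕ) (f : ℝ → ℝ) (x : ℝ) : ℝ :=
  ∑ k ∈ Finset.range (2 ^ n), fcoef f k * walsh k x

/-- Modulo trivial factors, `walsh k` is a product over any initial range of digits
containing those of `k`. -/
theorem walsh_eq_prod {n k : ℕ} (hk : k < 2 ^ n) (x : ℝ) :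
    walsh k x = ∏ m ∈ Finset.range n, if k.testBit m then rademacher m x else 1 := by
  have extend : ∀ M N, k < 2 ^ M → M ≤ N →
      ∏ m ∈ Finset.range M, (if k.testBit m then rademacher m x else 1) =
        ∏ m ∈ Finset.range N, if k.testBit m then rademacher m x else 1 := by
    intro M N hM hMN
    refine Finset.prod_subset (Finset.range_mono hMN) fun m _ hm => ?_
    rw [Finset.mem_range, not_lt] at hm
    simp [Nat.testBit_lt_two_pow (hM.trans_le (Nat.pow_le_pow_right two_pos hm))]
  rw [walsh, extend k (max k n) Nat.lt_two_pow_self (le_max_left _ _),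
    extend n (max k n) hk (le_max_right _ _)]

theorem walsh_two_pow_add {n k : ℕ} (hk : k < 2 ^ n) (x : ℝ) :
    walsh (2 ^ n + k) x = walsh k x * rademacher n x := by
  rw [walsh_eq_prod (n := n + 1) (by rw [pow_succ]; omega), Finset.prod_range_succ,
    walsh_eq_prod hk, Nat.testBit_two_pow_add_eq, Nat.testBit_lt_two_pow hk]
  congr 1
  refine Finset.prod_congr rfl fun m hm => ?_
  rw [Nat.testBit_two_pow_add_gt (Finset.mem_range.1 hm)]

theorem binDigit_eq (k : ℕ) (x : ℝ) : binDigit k x = ⌊x * 2 ^ (k + 1)⌋₊ % 2 := by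
  rw [binDigit, Int.floor_toNat]

theorem floor_mul_two_pow_succ_div_two (n : ℕ) (x : ℝ) :
    ⌊x * 2 ^ (n + 1)⌋₊ / 2 = ⌊x * 2 ^ n⌋₊ := by
  rw [← Nat.floor_div_ofNat, pow_succ]
  congr 1
  ring

theorem rademacher_eq_one_or_neg_one (k : ℕ) (x : ℝ) :
    rademacher k x = 1 ∨ rademacher k x = -1 :=
  neg_one_pow_eq_or ℝ _

/-- The Walsh–Dirichlet kernel of order `2 ^ n`. -/
theorem sum_walsh_mul_walsh (n : ℕ) {x t : ℝ} (hx : x < 1) (ht : t < 1) :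
    ∑ k ∈ Finset.range (2 ^ n), walsh k t * walsh k x =
      if ⌊t * 2 ^ n⌋₊ = ⌊x * 2 ^ n⌋₊ then 2 ^ n else 0 := by
  induction n with
  | zero => simp [walsh, Nat.floor_eq_zero.2 hx, Nat.floor_eq_zero.2 ht]
  | succ n ih =>
    have hstep : ∑ k ∈ Finset.range (2 ^ (n + 1)), walsh k t * walsh k x =
        (1 + rademacher n t * rademacher n x) *
          ∑ k ∈ Finset.range (2 ^ n), walsh k t * walsh k x := by
      rw [pow_succ, mul_two, Finset.sum_range_add, add_mul, one_mul, Finset.mul_sum]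
      congr 1
      refine Finset.sum_congr rfl fun k hk => ?_
      rw [walsh_two_pow_add (Finset.mem_range.1 hk), walsh_two_pow_add (Finset.mem_range.1 hk)]
      ring
    rw [hstep, ih, rademacher, rademacher, binDigit_eq, binDigit_eq,
      ← floor_mul_two_pow_succ_div_two n t, ← floor_mul_two_pow_succ_div_two n x]
    generalize ⌊t * 2 ^ (n + 1)⌋₊ = a
    generalize ⌊x * 2 ^ (n + 1)⌋₊ = b
    by_cases hab : a = b
    · subst hab
      rcases Nat.mod_two_eq_zero_or_one a with h | h <;> simp [h, pow_succ] <;> ring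
    · by_cases hd : a / 2 = b / 2
      · rcases Nat.mod_two_eq_zero_or_one a with h | h <;>
          rcases Nat.mod_two_eq_zero_or_one b with h' | h' <;>
          first
          | (exfalso; omega)
          | simp [h, h', hab]
      · simp [hab, hd]

theorem walsh_congr {n k : ℕ} (hk : k < 2 ^ n) {x t : ℝ}
    (h : ⌊t * 2 ^ n⌋₊ = ⌊x * 2 ^ n⌋₊) : walsh k t = walsh k x := by
  induction n generalizing k with
  | zero =>
    obtain rfl : k = 0 := by simpa using hk
    simp [walsh]
  | succ n ih =>
    have h' : ⌊t * 2 ^ n⌋₊ = ⌊x * 2 ^ n⌋₊ := by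
      rw [← floor_mul_two_pow_succ_div_two, h, floor_mul_two_pow_succ_div_two]
    have hr : rademacher n t = rademacher n x := by
      rw [rademacher, rademacher, binDigit_eq, binDigit_eq, h]
    rcases lt_or_ge k (2 ^ n) with hlt | hge
    · exact ih hlt h'
    · obtain ⟨l, rfl⟩ := Nat.exists_eq_add_of_le hge
      have hl : l < 2 ^ n := by rw [pow_succ] at hk; omega
      rw [walsh_two_pow_add hl, walsh_two_pow_add hl, ih hl h', hr]

theorem S2_congr {n : ℕ} (f : ℝ → ℝ) {x t : ℝ} (h : ⌊t * 2 ^ n⌋₊ = ⌊x * 2 ^ n⌋₊) :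
    S2 n f t = S2 n f x :=
  Finset.sum_congr rfl fun _ hk => by rw [walsh_congr (Finset.mem_range.1 hk) h]

theorem floor_mul_two_pow_eq {n j : ℕ} {t : ℝ} (h1 : (j : ℝ) / 2 ^ n ≤ t)
    (h2 : t < ((j + 1 : ℕ) : ℝ) / 2 ^ n) : ⌊t * 2 ^ n⌋₊ = j := by
  have hp : (0 : ℝ) < 2 ^ n := by positivity
  rw [div_le_iff₀ hp] at h1
  rw [lt_div_iff₀ hp] at h2
  rw [Nat.floor_eq_iff (j.cast_nonneg.trans h1)]
  exact ⟨h1, by exact_mod_cast h2⟩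

theorem measurable_walsh (k : ℕ) : Measurable (walsh k) := by
  have hr : ∀ m, Measurable (rademacher m) := fun m => by
    have h : Measurable fun x : ℝ => ⌊x * 2 ^ (m + 1)⌋₊ :=
      Nat.measurable_floor.comp (measurable_id.mul_const _)
    have h' : rademacher m = (fun a : ℕ => (-1 : ℝ) ^ (a % 2)) ∘
        fun x : ℝ => ⌊x * 2 ^ (m + 1)⌋₊ := by
      ext x
      simp [rademacher, binDigit_eq]
    rw [h']
    exact (measurable_of_countable _).comp h
  unfold walsh
  refine Finset.measurable_prod _ fun m _ => ?_
  split_ifs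
  · exact hr m
  · exact measurable_const

theorem abs_walsh (k : ℕ) (x : ℝ) : |walsh k x| = 1 := by
  rw [walsh, Finset.abs_prod]
  refine Finset.prod_eq_one fun m _ => ?_
  split_ifs
  · rcases rademacher_eq_one_or_neg_one m x with h | h <;> simp [h]
  · simp

theorem IntervalIntegrable.mul_walsh {f : ℝ → ℝ} {a b : ℝ} (hf : IntervalIntegrable f volume a b)
    (k : ℕ) : IntervalIntegrable (fun t => f t * walsh k t) volume a b := by
  have h : ∀ s : Set ℝ, IntegrableOn f s → IntegrableOn (fun t => f t * walsh k t) s :=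
    fun s hs => Integrable.mul_bdd (c := 1) hs (measurable_walsh k).aestronglyMeasurable
      (.of_forall fun t => (abs_walsh k t).le)
  exact ⟨h _ hf.1, h _ hf.2⟩

/-- `S2 n f` is the average of `f` over dyadic intervals of length `2 ^ (-n)`. -/
theorem S2_eq_integral {n j : ℕ} (hj : j < 2 ^ n) {f : ℝ → ℝ}
    (hf : IntervalIntegrable f volume 0 1) :
    S2 n f ((j : ℝ) / 2 ^ n) =
      2 ^ n * ∫ t in ((j : ℝ) / 2 ^ n)..(((j + 1 : ℕ) : ℝ) / 2 ^ n), f t := by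
  have hp : (0 : ℝ) < 2 ^ n := by positivity
  set x : ℝ := (j : ℝ) / 2 ^ n with hx
  set y : ℝ := ((j + 1 : ℕ) : ℝ) / 2 ^ n with hy
  have hx0 : 0 ≤ x := by positivity
  have hxy : x < y := by rw [hx, hy]; gcongr; simp
  have hy1 : y ≤ 1 := by
    rw [hy, div_le_one hp]
    exact_mod_cast hj
  have hfx : ⌊x * 2 ^ n⌋₊ = j := floor_mul_two_pow_eq le_rfl hxy
  have hsum : S2 n f x =
      ∫ t in (0 : ℝ)..1, ∑ k ∈ Finset.range (2 ^ n), f t * walsh k t * walsh k x := by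
    rw [intervalIntegral.integral_finsetSum fun k _ => (hf.mul_walsh k).mul_const _]
    exact Finset.sum_congr rfl fun k _ => (intervalIntegral.integral_mul_const _ _).symm
  have hker : S2 n f x =
      ∫ t in (0 : ℝ)..1, f t * if ⌊t * 2 ^ n⌋₊ = j then 2 ^ n else 0 := by
    rw [hsum]
    refine intervalIntegral.integral_congr_Ioo_of_le zero_le_one fun t ht => ?_
    simp only [mul_assoc]
    rw [← Finset.mul_sum, sum_walsh_mul_walsh n (hxy.trans_le hy1) ht.2, hfx]
  have hl : Set.EqOn (fun _ => (0 : ℝ)) (fun t => f t * if ⌊t * 2 ^ n⌋₊ = j then 2 ^ n else 0)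
      (Set.uIoo 0 x) := by
    rw [Set.uIoo_of_le hx0]
    intro t ht
    have : ⌊t * 2 ^ n⌋₊ < j :=
      (Nat.floor_lt (mul_nonneg ht.1.le hp.le)).2 ((lt_div_iff₀ hp).1 ht.2)
    simp [this.ne]
  have hm : Set.EqOn (fun t => 2 ^ n * f t) (fun t => f t * if ⌊t * 2 ^ n⌋₊ = j then 2 ^ n else 0)
      (Set.uIoo x y) := by
    rw [Set.uIoo_of_le hxy.le]
    intro t ht
    simp [floor_mul_two_pow_eq ht.1.le ht.2, mul_comm]
  have hr : Set.EqOn (fun _ => (0 : ℝ)) (fun t => f t * if ⌊t * 2 ^ n⌋₊ = j then 2 ^ n else 0)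
      (Set.uIoo y 1) := by
    rw [Set.uIoo_of_le hy1]
    intro t ht
    have : j + 1 ≤ ⌊t * 2 ^ n⌋₊ := Nat.le_floor ((div_le_iff₀ hp).1 ht.1.le)
    simp [show ⌊t * 2 ^ n⌋₊ ≠ j by omega]
  have hfm : IntervalIntegrable f volume x y := by
    refine hf.mono_set ?_
    rw [Set.uIcc_of_le hxy.le, Set.uIcc_of_le zero_le_one]
    exact Set.Icc_subset_Icc hx0 hy1
  have il := intervalIntegrable_const.congr_uIoo (μ := volume) hl
  have im := (hfm.const_mul (2 ^ n)).congr_uIoo hm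
  have ir := intervalIntegrable_const.congr_uIoo (μ := volume) hr
  rw [hker, ← intervalIntegral.integral_add_adjacent_intervals (il.trans im) ir,
    ← intervalIntegral.integral_add_adjacent_intervals il im,
    ← intervalIntegral.integral_congr_uIoo hl, ← intervalIntegral.integral_congr_uIoo hm,
    ← intervalIntegral.integral_congr_uIoo hr]
  simp

/-- Integrating over part of a dyadic interval a function which is constant on it. -/
theorem integral_of_dyadic_const {n j : ℕ} {g : ℝ → ℝ} {u v c : ℝ}
    (hg : ∀ t, ⌊t * 2 ^ n⌋₊ = j → g t = c)
    (hu : (j : ℝ) / 2 ^ n ≤ u) (huv : u ≤ v) (hv : v ≤ ((j + 1 : ℕ) : ℝ) / 2 ^ n) :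
    IntervalIntegrable g volume u v ∧ ∫ t in u..v, g t = (v - u) * c := by
  have h : Set.EqOn (fun _ => c) g (Set.uIoo u v) := by
    rw [Set.uIoo_of_le huv]
    exact fun t ht =>
      (hg t (floor_mul_two_pow_eq (hu.trans ht.1.le) (ht.2.trans_le hv))).symm
  refine ⟨intervalIntegrable_const.congr_uIoo h, ?_⟩
  rw [← intervalIntegral.integral_congr_uIoo h, intervalIntegral.integral_const, smul_eq_mul]

/-- The average over a dyadic interval to the left of `ξ` of the primitive, based at `ξ`, of a
dyadic step function. -/
theorem S2_primitive_of_lt {n j m : ℕ} (hjm : j < m) (hm : m < 2 ^ n) {ξ : ℝ}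
    (h1 : (m : ℝ) / 2 ^ n ≤ ξ) (h2 : ξ ≤ ((m + 1 : ℕ) : ℝ) / 2 ^ n) {g : ℝ → ℝ} {G : ℕ → ℝ}
    (hg : ∀ t, g t = G ⌊t * 2 ^ n⌋₊) :
    S2 n (fun s => ∫ t in ξ..s, g t) ((j : ℝ) / 2 ^ n) =
      G m * ((m : ℝ) / 2 ^ n - ξ) - ∑ k ∈ Finset.Ico (j + 1) m, G k / 2 ^ n -
        G j / 2 ^ (n + 1) := by
  have hp : (0 : ℝ) < 2 ^ n := by positivity
  set a : ℕ → ℝ := fun k => (k : ℝ) / 2 ^ n with ha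
  have hmono : ∀ k, a k ≤ a (k + 1) := fun k => by simp only [ha]; gcongr; simp
  have hpart : ∀ k u v, a k ≤ u → u ≤ v → v ≤ a (k + 1) →
      IntervalIntegrable g volume u v ∧ ∫ t in u..v, g t = (v - u) * G k :=
    fun k u v => integral_of_dyadic_const fun t ht => by rw [hg, ht]
  have hcell : ∀ k, IntervalIntegrable g volume (a k) (a (k + 1)) :=
    fun k => (hpart k _ _ le_rfl (hmono k) le_rfl).1
  have hlen : ∀ k, a (k + 1) - a k = 1 / 2 ^ n := fun k => by simp only [ha]; push_cast; ring
  have htail : IntervalIntegrable g volume (a (j + 1)) (a m) :=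
    IntervalIntegrable.trans_iterate_Ico hjm fun k _ => hcell k
  have hlast := hpart m (a m) ξ le_rfl h1 h2
  have h01 : IntervalIntegrable g volume 0 1 := by
    have := IntervalIntegrable.trans_iterate (μ := volume) (a := a) (n := 2 ^ n) fun k _ => hcell k
    simpa [ha] using this
  have hξ : ξ ∈ Set.uIcc (0 : ℝ) 1 := by
    rw [Set.uIcc_of_le zero_le_one]
    refine ⟨le_trans (by positivity) h1, h2.trans ?_⟩
    rw [div_le_one hp]
    exact_mod_cast hm
  have hF : IntervalIntegrable (fun s => ∫ t in ξ..s, g t) volume 0 1 :=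
    (intervalIntegral.continuousOn_primitive_interval' h01 hξ).intervalIntegrable
  set C : ℝ := G m * (a m - ξ) - ∑ k ∈ Finset.Ico (j + 1) m, G k / 2 ^ n with hC
  have hval : Set.EqOn (fun s => ∫ t in ξ..s, g t) (fun s => C - G j * (a (j + 1) - s))
      (Set.uIcc (a j) (a (j + 1))) := by
    rw [Set.uIcc_of_le (hmono j)]
    intro s hs
    have hfirst := hpart j s (a (j + 1)) hs.1 hs.2 le_rfl
    have hsum : ∫ t in (a (j + 1))..(a m), g t = ∑ k ∈ Finset.Ico (j + 1) m, G k / 2 ^ n := by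
      rw [← intervalIntegral.sum_integral_adjacent_intervals_Ico hjm fun k _ => hcell k]
      refine Finset.sum_congr rfl fun k _ => ?_
      rw [(hpart k _ _ le_rfl (hmono k) le_rfl).2, hlen]
      ring
    change ∫ t in ξ..s, g t = _
    rw [intervalIntegral.integral_symm,
      ← intervalIntegral.integral_add_adjacent_intervals (hfirst.1.trans htail) hlast.1,
      ← intervalIntegral.integral_add_adjacent_intervals hfirst.1 htail, hfirst.2, hsum, hlast.2,
      hC]
    ring
  clear_value C
  rw [S2_eq_integral (hjm.trans hm) hF, intervalIntegral.integral_congr hval,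
    intervalIntegral.integral_sub (by simp) (by apply Continuous.intervalIntegrable; fun_prop),
    intervalIntegral.integral_const_mul,
    intervalIntegral.integral_sub (by simp) (by apply Continuous.intervalIntegrable; fun_prop),
    integral_id, intervalIntegral.integral_const, intervalIntegral.integral_const]
  have h := hlen j
  have h' : a (j + 1) = a j + 1 / 2 ^ n := by linarith
  rw [h']
  simp only [smul_eq_mul]
  field_simp
  ring

/-- Case `k* > i` of the multistep algorithm: the recursion for the discretized
solution on dyadic intervals to the left of the one containing `ξ`. -/
theorem multistep_case_less (p q : ℝ → ℝ)
    (hpi : IntegrableOn p (Set.Ico (0:ℝ) 1)) (hqi : IntegrableOn q (Set.Ico (0:ℝ) 1))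
    (ξ : ℝ) (hξ : ξ ∈ Set.Ico (0:ℝ) 1) (η : ℝ) (n : ℕ) (hn : 1 ≤ n)
    (kstar : ℕ) (hk1 : 1 ≤ kstar) (hk2 : kstar ≤ 2 ^ n)
    (hξ1 : ((kstar : ℝ) - 1) / 2 ^ n ≤ ξ) (hξ2 : ξ < (kstar : ℝ) / 2 ^ n)
    (ybar : ℝ → ℝ)
    (hpoly : ∃ c : Fin (2 ^ n) → ℝ, ∀ x : ℝ, ybar x = ∑ k : Fin (2 ^ n), c k * walsh k.1 x)
    (heq : ∀ x ∈ Set.Ico (0:ℝ) 1,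
      ybar x = η + S2 n (fun s => ∫ t in ξ..s, (S2 n q t - S2 n p t * ybar t)) x) :
    ∀ i : ℕ, 1 ≤ i → i < kstar →
      ybar (((i : ℝ) - 1) / 2 ^ n) *
          (1 - S2 n p (((i : ℝ) - 1) / 2 ^ n) / 2 ^ (n + 1)) =
        η + (S2 n q (((kstar : ℝ) - 1) / 2 ^ n) -
              S2 n p (((kstar : ℝ) - 1) / 2 ^ n) * ybar (((kstar : ℝ) - 1) / 2 ^ n)) *
            (((kstar : ℝ) - 1) / 2 ^ n - ξ) -
          (∑ k ∈ Finset.Ioo i kstar,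
            (S2 n q (((k : ℝ) - 1) / 2 ^ n) -
              S2 n p (((k : ℝ) - 1) / 2 ^ n) * ybar (((k : ℝ) - 1) / 2 ^ n)) / 2 ^ n) -
          S2 n q (((i : ℝ) - 1) / 2 ^ n) / 2 ^ (n + 1) := by
  intro i hi hik
  obtain ⟨j, rfl⟩ := Nat.exists_eq_add_of_le' hi
  obtain ⟨m, rfl⟩ := Nat.exists_eq_add_of_le' hk1
  obtain ⟨c, hc⟩ := hpoly
  have hjm : j < m := by omega
  have hp : (0 : ℝ) < 2 ^ n := by positivity
  have hfloor : ∀ k : ℕ, ⌊(k : ℝ) / 2 ^ n * 2 ^ n⌋₊ = k := fun k => by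
    rw [div_mul_cancel₀ _ hp.ne', Nat.floor_natCast]
  have hy : ∀ t x, ⌊t * 2 ^ n⌋₊ = ⌊x * 2 ^ n⌋₊ → ybar t = ybar x := fun t x h => by
    rw [hc, hc]
    exact Finset.sum_congr rfl fun k _ => by rw [walsh_congr k.2 h]
  set G : ℕ → ℝ := fun k => S2 n q ((k : ℝ) / 2 ^ n) -
    S2 n p ((k : ℝ) / 2 ^ n) * ybar ((k : ℝ) / 2 ^ n) with hG
  have hg : ∀ t, S2 n q t - S2 n p t * ybar t = G ⌊t * 2 ^ n⌋₊ := fun t => by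
    have h := (hfloor ⌊t * 2 ^ n⌋₊).symm
    simp only [hG]
    rw [S2_congr q h, S2_congr p h, hy _ _ h]
  have hcast : ∀ k : ℕ, ((k + 1 : ℕ) : ℝ) - 1 = k := fun k => by push_cast; ring
  rw [hcast] at hξ1
  have hsol := heq ((j : ℝ) / 2 ^ n) ⟨by positivity, by
    rw [div_lt_one hp]
    exact_mod_cast (by omega : j < 2 ^ n)⟩
  rw [S2_primitive_of_lt hjm (by omega) hξ1 hξ2.le hg] at hsol
  have hshift : ∑ k ∈ Finset.Ioo (j + 1) (m + 1), (S2 n q (((k : ℝ) - 1) / 2 ^ n) -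
      S2 n p (((k : ℝ) - 1) / 2 ^ n) * ybar (((k : ℝ) - 1) / 2 ^ n)) / 2 ^ n =
      ∑ k ∈ Finset.Ico (j + 1) m, G k / 2 ^ n := by
    rw [show Finset.Ioo (j + 1) (m + 1) = Finset.Ico (j + 1 + 1) (m + 1) by
        ext; simp only [Finset.mem_Ioo, Finset.mem_Ico]; omega,
      ← Finset.sum_Ico_add']
    exact Finset.sum_congr rfl fun k _ => by rw [hcast]
  rw [hshift, hcast, hcast]
  simp only [hG] at hsol ⊢
  linear_combination hsol
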